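/- For all x, y, z ∈ W, one has (x ▷ y) ◁ z = x ▷ (y ◁ z). -/

import Mathlib

/-! Common setup: a finite Coxeter system, Bruhat order, and the sets
`{u * y : u ≤ x}` and `{x * v : v ≤ y}` used to characterize the
Demazure product `∗` and the operations `▷`, `◁`. -/

/-- The Bruhat order on a Coxeter group: the reflexive-transitive closure of
the relation `u → u * t`, where `t` is a reflection and right multiplication
by `t` increases length. -/
def CoxeterSystem.bruhatLE {B W : Type*} [Group W] {M : CoxeterMatrix B}
    (cs : CoxeterSystem M W) : W → W → Prop :=
  Relation.ReflTransGen
    (fun u v => ∃ t, cs.IsReflection t ∧ v = u * t ∧ cs.length u < cs.length v)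

/-- The set `{u * y : u ∈ W, u ≤ x}`. -/
def CoxeterSystem.lset {B W : Type*} [Group W] {M : CoxeterMatrix B}
    (cs : CoxeterSystem M W) (x y : W) : Set W :=
  {z | ∃ u, cs.bruhatLE u x ∧ z = u * y}

/-- The set `{x * v : v ∈ W, v ≤ y}`. -/
def CoxeterSystem.rset {B W : Type*} [Group W] {M : CoxeterMatrix B}
    (cs : CoxeterSystem M W) (x y : W) : Set W :=
  {z | ∃ v, cs.bruhatLE v y ∧ z = x * v}

namespace CoxeterSystem

variable {B W : Type*} [Group W] {M : CoxeterMatrix B} (cs : CoxeterSystem M W)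

section StrongExchange

lemma end_mul_apply {α : Type*} (f g : Function.End α) (a : α) : (f * g) a = f (g a) :=
  rfl

open Classical in
/-- The action of a simple reflection on pairs of a group element and a sign. -/
noncomputable def signedConj (i : B) : Function.End (W × ZMod 2) :=
  fun p => (cs.simple i * p.1 * cs.simple i, p.2 + if p.1 = cs.simple i then 1 else 0)

lemma conj_pow_eq_simple_mul_pow_iff (i j : B) (n k : ℕ) (t : W) :
    (cs.simple i * cs.simple j) ^ n * t * ((cs.simple i * cs.simple j) ^ n)⁻¹ =
        cs.simple j * (cs.simple i * cs.simple j) ^ k ↔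
      t = cs.simple j * (cs.simple i * cs.simple j) ^ (2 * n + k) := by
  have h : SemiconjBy (cs.simple j) (cs.simple i * cs.simple j) (cs.simple i * cs.simple j)⁻¹ := by
    simp [SemiconjBy, mul_assoc]
  have h' := (h.pow_right n).eq
  rw [show 2 * n + k = n + (k + n) by ring, pow_add, pow_add, ← mul_assoc, h', inv_pow,
    mul_inv_eq_iff_eq_mul, mul_assoc, mul_assoc, eq_inv_mul_iff_mul_eq]

lemma conj_pow_eq_simple_iff (i j : B) (n : ℕ) (t : W) :
    (cs.simple i * cs.simple j) ^ n * t * ((cs.simple i * cs.simple j) ^ n)⁻¹ = cs.simple j ↔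
      t = cs.simple j * (cs.simple i * cs.simple j) ^ (2 * n) := by
  simpa using cs.conj_pow_eq_simple_mul_pow_iff i j n 0 t

lemma simple_mul_conj_pow_mul_simple_eq_simple_iff (i j : B) (n : ℕ) (t : W) :
    cs.simple j * ((cs.simple i * cs.simple j) ^ n * t * ((cs.simple i * cs.simple j) ^ n)⁻¹) *
        cs.simple j = cs.simple i ↔
      t = cs.simple j * (cs.simple i * cs.simple j) ^ (2 * n + 1) := by
  rw [← conj_pow_eq_simple_mul_pow_iff, ← eq_mul_inv_iff_mul_eq, ← eq_inv_mul_iff_mul_eq,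
    inv_simple, pow_one]

open Classical in
lemma signedConj_mul_pow_apply (i j : B) (n : ℕ) (t : W) (ε : ZMod 2) :
    ((cs.signedConj i * cs.signedConj j) ^ n) (t, ε) =
      ((cs.simple i * cs.simple j) ^ n * t * ((cs.simple i * cs.simple j) ^ n)⁻¹,
        ε + ∑ k ∈ Finset.range (2 * n),
          if t = cs.simple j * (cs.simple i * cs.simple j) ^ k then 1 else 0) := by
  induction n with
  | zero => simp [Function.End.one_def]
  | succ n ih =>
    rw [pow_succ', end_mul_apply, ih, end_mul_apply]
    simp only [signedConj, conj_pow_eq_simple_iff, simple_mul_conj_pow_mul_simple_eq_simple_iff]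
    rw [show 2 * (n + 1) = 2 * n + 1 + 1 by ring, Finset.sum_range_succ, Finset.sum_range_succ]
    ext
    · simp [pow_succ', mul_assoc]
    · simp [add_assoc]

lemma isLiftable_signedConj : M.IsLiftable cs.signedConj := by
  classical
  intro i j
  funext ⟨t, ε⟩
  rw [signedConj_mul_pow_apply, cs.simple_mul_simple_pow, two_mul, Finset.sum_range_add]
  simp [pow_add, CharTwo.add_self_eq_zero, Function.End.one_def]

/-- The parity of the number of occurrences of `t` in the right inversion sequence of any word
representing `w`. -/
noncomputable def inversionParity (w t : W) : ZMod 2 :=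
  (cs.lift ⟨cs.signedConj, cs.isLiftable_signedConj⟩ w (t, 0)).2

lemma lift_signedConj_apply (w t : W) (ε : ZMod 2) :
    cs.lift ⟨cs.signedConj, cs.isLiftable_signedConj⟩ w (t, ε) =
      (w * t * w⁻¹, ε + cs.inversionParity w t) := by
  unfold inversionParity
  induction w using cs.simple_induction_left generalizing ε with
  | one => simp [Function.End.one_def]
  | mul_simple_left w i ih =>
    rw [map_mul, end_mul_apply, end_mul_apply, ih, ih 0, lift_apply_simple]
    ext <;> simp [signedConj, mul_assoc, add_assoc]

lemma inversionParity_mul (x y t : W) :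
    cs.inversionParity (x * y) t =
      cs.inversionParity y t + cs.inversionParity x (y * t * y⁻¹) := by
  rw [inversionParity, map_mul, end_mul_apply, lift_signedConj_apply,
    lift_signedConj_apply, zero_add]

@[simp]
lemma inversionParity_one (t : W) : cs.inversionParity 1 t = 0 := by
  simp [inversionParity, Function.End.one_def]

open Classical in
lemma inversionParity_simple (i : B) (t : W) :
    cs.inversionParity (cs.simple i) t = if t = cs.simple i then 1 else 0 := by
  simp [inversionParity, lift_apply_simple, signedConj]

lemma inversionParity_self {t : W} (ht : cs.IsReflection t) : cs.inversionParity t t = 1 := by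
  obtain ⟨w, i, rfl⟩ := ht
  have h := cs.inversionParity_mul w w⁻¹ (w * cs.simple i * w⁻¹)
  rw [mul_inv_cancel, inversionParity_one] at h
  rw [inversionParity_mul, inversionParity_mul]
  simp only [inversionParity_simple, mul_assoc, inv_mul_cancel_left, inv_inv,
    inv_mul_cancel, mul_one, inv_simple, simple_mul_simple_self, one_mul, if_true] at h ⊢
  linear_combination -h

lemma mem_rightInvSeq_of_inversionParity_ne_zero (ω : List B) {t : W}
    (h : cs.inversionParity (cs.wordProd ω) t ≠ 0) : t ∈ cs.rightInvSeq ω := by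
  classical
  induction ω with
  | nil => simp at h
  | cons i ω ih =>
    rw [wordProd_cons, inversionParity_mul, inversionParity_simple] at h
    rw [rightInvSeq, List.mem_cons]
    by_cases hω : cs.inversionParity (cs.wordProd ω) t = 0
    · left
      rw [hω, zero_add, ite_ne_right_iff, mul_inv_eq_iff_eq_mul] at h
      rw [mul_assoc, eq_inv_mul_iff_mul_eq, h.1]
    · exact Or.inr (ih hω)

lemma length_mul_lt_of_inversionParity_ne_zero {w t : W} (h : cs.inversionParity w t ≠ 0) :
    cs.length (w * t) < cs.length w := by
  obtain ⟨ω, hω, rfl⟩ := cs.exists_isReduced w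
  exact (cs.isRightInversion_of_mem_rightInvSeq hω
    (cs.mem_rightInvSeq_of_inversionParity_ne_zero ω h)).2

/-- A form of the strong exchange property. -/
lemma inversionParity_ne_zero_iff {w t : W} (ht : cs.IsReflection t) :
    cs.inversionParity w t ≠ 0 ↔ cs.length (w * t) < cs.length w := by
  refine ⟨cs.length_mul_lt_of_inversionParity_ne_zero, fun h h0 => ?_⟩
  have h1 : cs.inversionParity (w * t) t ≠ 0 := by
    rw [inversionParity_mul, cs.inversionParity_self ht, mul_inv_cancel_right, h0]
    decide
  have h2 := cs.length_mul_lt_of_inversionParity_ne_zero h1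
  rw [mul_assoc, ht.mul_self, mul_one] at h2
  exact h.not_gt h2

end StrongExchange

section Bruhat

variable {cs}

lemma bruhatLE.eq_or_length_lt {x y : W} (h : cs.bruhatLE x y) :
    x = y ∨ cs.length x < cs.length y := by
  induction h with
  | refl => exact Or.inl rfl
  | tail _ hstep ih =>
    obtain ⟨t, -, -, hlt⟩ := hstep
    rcases ih with rfl | ih
    · exact Or.inr hlt
    · exact Or.inr (ih.trans hlt)

lemma bruhatLE.antisymm {x y : W} (hxy : cs.bruhatLE x y) (hyx : cs.bruhatLE y x) : x = y := by
  rcases hxy.eq_or_length_lt with h | h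
  · exact h
  · rcases hyx.eq_or_length_lt with h' | h'
    · exact h'.symm
    · exact absurd h h'.not_gt

lemma bruhatLE.trans {x y z : W} (hxy : cs.bruhatLE x y) (hyz : cs.bruhatLE y z) :
    cs.bruhatLE x z :=
  Relation.ReflTransGen.trans hxy hyz

lemma bruhatLE.inv {x y : W} (h : cs.bruhatLE x y) : cs.bruhatLE x⁻¹ y⁻¹ := by
  induction h with
  | refl => exact Relation.ReflTransGen.refl
  | @tail b c _ hstep ih =>
    obtain ⟨t, ht, rfl, hlt⟩ := hstep
    refine ih.tail ⟨b * t * b⁻¹, ht.conj b, ?_, by simpa only [length_inv] using hlt⟩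
    simp [ht.inv, mul_assoc]

variable (cs)

lemma bruhatLE_mul_simple {w : W} {i : B} (h : cs.length w < cs.length (w * cs.simple i)) :
    cs.bruhatLE w (w * cs.simple i) :=
  .single ⟨_, cs.isReflection_simple i, rfl, h⟩

lemma eq_simple_or_bruhatLE_mul_simple {a t : W} (ht : cs.IsReflection t)
    (hlt : cs.length a < cs.length (a * t)) (i : B) :
    t = cs.simple i ∨ cs.bruhatLE (a * cs.simple i) (a * t * cs.simple i) := by
  have hr : cs.IsReflection (cs.simple i * t * cs.simple i) := by
    simpa using ht.conj (cs.simple i)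
  have hmul : a * cs.simple i * (cs.simple i * t * cs.simple i) = a * t * cs.simple i := by
    simp [mul_assoc]
  refine or_iff_not_imp_left.mpr fun hne => .single ⟨_, hr, hmul.symm, ?_⟩
  have hzero : cs.inversionParity (a * cs.simple i) (cs.simple i * t * cs.simple i) = 0 := by
    have ha : cs.inversionParity a t = 0 := by
      by_contra h
      exact hlt.not_gt (cs.length_mul_lt_of_inversionParity_ne_zero h)
    rw [inversionParity_mul, inversionParity_simple, if_neg, zero_add]
    · simpa [mul_assoc] using ha
    · intro h
      apply hne
      have := congrArg (fun u => cs.simple i * u * cs.simple i) h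
      simpa [mul_assoc] using this
  have hnot := mt (cs.inversionParity_ne_zero_iff (w := a * cs.simple i) hr).mpr (not_not.mpr hzero)
  have hne' := hr.length_mul_left_ne (a * cs.simple i)
  rw [hmul] at hnot hne'
  omega

variable {cs}

/-- The lower form of the lifting property. -/
lemma bruhatLE.le_mul_simple_or {a b : W} (h : cs.bruhatLE a b) (i : B) :
    cs.bruhatLE a (b * cs.simple i) ∨ cs.bruhatLE (a * cs.simple i) (b * cs.simple i) := by
  induction h with
  | refl => exact Or.inr .refl
  | @tail b c hab hstep ih =>
    obtain ⟨t, ht, rfl, hlt⟩ := hstep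
    rcases cs.eq_simple_or_bruhatLE_mul_simple ht hlt i with rfl | h
    · left
      rwa [mul_assoc, simple_mul_simple_self, mul_one]
    · exact ih.imp (·.trans h) (·.trans h)

/-- The upper form of the lifting property. -/
lemma bruhatLE.mul_simple_le_or {a b : W} (h : cs.bruhatLE a b) (i : B) :
    cs.bruhatLE (a * cs.simple i) b ∨ cs.bruhatLE (a * cs.simple i) (b * cs.simple i) := by
  induction h with
  | refl => exact Or.inr .refl
  | @tail b c hab hstep ih =>
    rcases ih with ih | ih
    · exact Or.inl (Relation.ReflTransGen.tail ih hstep)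
    · obtain ⟨t, ht, rfl, hlt⟩ := hstep
      rcases cs.eq_simple_or_bruhatLE_mul_simple ht hlt i with rfl | h
      · exact Or.inl ih
      · exact Or.inr (ih.trans h)

lemma bruhatLE.exists_mul_right_le {a b : W} (h : cs.bruhatLE a b) (v : W) :
    ∃ v', cs.bruhatLE v' v ∧ cs.bruhatLE (a * v') (b * v) := by
  induction hn : cs.length v using Nat.strong_induction_on generalizing v with
  | _ n ih =>
    by_cases hv : v = 1
    · exact ⟨1, hv ▸ .refl, by simpa [hv] using h⟩
    obtain ⟨i, hi⟩ := cs.exists_rightDescent_of_ne_one hv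
    obtain ⟨u, rfl⟩ : ∃ u, v = u * cs.simple i := ⟨v * cs.simple i, by simp⟩
    have hlt : cs.length u < cs.length (u * cs.simple i) := by
      simpa [IsRightDescent] using hi
    obtain ⟨u', hu', hle⟩ := ih _ (hn ▸ hlt) u rfl
    have hu := cs.bruhatLE_mul_simple hlt
    rw [← mul_assoc]
    rcases hle.le_mul_simple_or i with h' | h'
    · exact ⟨u', hu'.trans hu, h'⟩
    · refine ⟨u' * cs.simple i, ?_, by rwa [← mul_assoc]⟩
      exact (hu'.mul_simple_le_or i).elim (·.trans hu) id

lemma bruhatLE.exists_mul_left_le {a b : W} (h : cs.bruhatLE a b) (u : W) :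
    ∃ u', cs.bruhatLE u' u ∧ cs.bruhatLE (u' * a) (u * b) := by
  obtain ⟨v, hv, hle⟩ := h.inv.exists_mul_right_le u⁻¹
  exact ⟨v⁻¹, by simpa using hv.inv, by simpa using hle.inv⟩

end Bruhat

end CoxeterSystem

/-- For all `x y z ∈ W`: `(x ▷ y) ◁ z = x ▷ (y ◁ z)`. -/
theorem rtr_ltr_assoc {B W : Type*} [Group W] [Finite W] {M : CoxeterMatrix B}
    (cs : CoxeterSystem M W) (rtr ltr : W → W → W)
    (hrtr : ∀ x y : W, rtr x y ∈ cs.lset x y ∧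
      ∀ z ∈ cs.lset x y, cs.bruhatLE (rtr x y) z)
    (hltr : ∀ x y : W, ltr x y ∈ cs.rset x y ∧
      ∀ z ∈ cs.rset x y, cs.bruhatLE (ltr x y) z)
    (x y z : W) :
    ltr (rtr x y) z = rtr x (ltr y z) := by
  obtain ⟨⟨u, hu, hxu⟩, -⟩ := hrtr x (ltr y z)
  obtain ⟨⟨v, hv, hyv⟩, -⟩ := hltr y z
  obtain ⟨⟨v₁, hv₁, hxv⟩, -⟩ := hltr (rtr x y) z
  obtain ⟨⟨u₁, hu₁, hyu⟩, -⟩ := hrtr x y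
  apply CoxeterSystem.bruhatLE.antisymm (cs := cs)
  · obtain ⟨v', hv', hle⟩ := ((hrtr x y).2 (u * y) ⟨u, hu, rfl⟩).exists_mul_right_le v
    rw [hxu, hyv, ← mul_assoc]
    exact ((hltr (rtr x y) z).2 _ ⟨v', hv'.trans hv, rfl⟩).trans hle
  · obtain ⟨u', hu', hle⟩ := ((hltr y z).2 (y * v₁) ⟨v₁, hv₁, rfl⟩).exists_mul_left_le u₁
    rw [hxv, hyu, mul_assoc]
    exact ((hrtr x (ltr y z)).2 _ ⟨u', hu'.trans hu₁, rfl⟩).trans hle
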